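/- Let G be a finite connected block graph on n ≥ 2 vertices (a graph in which every maximal 2-connected subgraph is a clique), and let k be the number of cut-vertices of G. Then meg(G) = n - k. -/

import Mathlib

open SimpleGraph

/-- A pair of vertices `u`, `v` monitors an edge `e` if `u` and `v` are reachable from
each other and `e` belongs to every shortest path (walk of length `G.dist u v`)
between `u` and `v`. -/
def Monitors {V : Type*} (G : SimpleGraph V) (u v : V) (e : Sym2 V) : Prop :=
  G.Reachable u v ∧ ∀ p : G.Walk u v, p.length = G.dist u v → e ∈ p.edges

/-- A monitoring edge-geodetic set of `G`: every edge of `G` is monitored by some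
pair of vertices of `M`. -/
def IsMEGSet {V : Type*} (G : SimpleGraph V) (M : Set V) : Prop :=
  ∀ e ∈ G.edgeSet, ∃ u ∈ M, ∃ v ∈ M, Monitors G u v e

/-- The monitoring edge-geodetic number of `G`: the minimum size of an MEG-set. -/
noncomputable def meg {V : Type*} [Fintype V] (G : SimpleGraph V) : ℕ :=
  sInf {n : ℕ | ∃ M : Finset V, IsMEGSet G ↑M ∧ M.card = n}

/-- A set `S` of vertices induces a 2-connected subgraph of `G`: it has at least 3 vertices,
induces a connected graph, and remains connected after deleting any single vertex. -/
def TwoConnectedOn {V : Type*} (G : SimpleGraph V) (S : Set V) : Prop :=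
  3 ≤ S.ncard ∧ (G.induce S).Connected ∧ ∀ v ∈ S, (G.induce (S \ {v})).Connected

namespace SimpleGraph

variable {V : Type*} {G : SimpleGraph V}

theorem induce_connected_of_forall_walk {s : Set V} {c : V} (hc : c ∈ s)
    (h : ∀ w ∈ s, ∃ p : G.Walk w c, ∀ x ∈ p.support, x ∈ s) : (G.induce s).Connected := by
  have key : ∀ w : s, (G.induce s).Reachable w ⟨c, hc⟩ := by
    rintro ⟨w, hw⟩
    obtain ⟨p, hp⟩ := h w hw
    exact ⟨p.induce s hp⟩
  have : Nonempty s := ⟨⟨c, hc⟩⟩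
  exact ⟨fun a b => (key a).trans (key b).symm⟩

theorem exists_isPath_avoiding {v a b : V} (h : (G.induce ({v}ᶜ : Set V)).Connected)
    (ha : a ≠ v) (hb : b ≠ v) : ∃ p : G.Walk a b, p.IsPath ∧ v ∉ p.support := by
  classical
  obtain ⟨q⟩ := h.preconnected ⟨a, ha⟩ ⟨b, hb⟩
  let f := (Embedding.induce (G := G) ({v}ᶜ : Set V)).toHom
  obtain ⟨q', hq'⟩ : ∃ p : G.Walk a b, v ∉ p.support := by
    refine ⟨q.map f, fun hv => ?_⟩
    have hv' : v ∈ q.support.map f := Walk.support_map f q ▸ hv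
    obtain ⟨y, -, hy⟩ := List.mem_map.1 hv'
    exact y.2 hy
  exact ⟨q'.bypass, q'.bypass_isPath, fun hv => hq' (q'.support_bypass_subset_support hv)⟩

/-- A path avoiding `v` between two distinct neighbours of `v` closes to a cycle through `v`,
whose vertex set is 2-connected. -/
theorem twoConnectedOn_insert_support [Finite V] {v a b : V} (hva : G.Adj v a) (hvb : G.Adj v b)
    (hab : a ≠ b) {p : G.Walk a b} (hp : p.IsPath) (hv : v ∉ p.support) :
    TwoConnectedOn G (insert v {x | x ∈ p.support}) := by
  classical
  refine ⟨?_, ?_, ?_⟩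
  · rw [← Set.ncard_eq_three.2 ⟨v, a, b, hva.ne, hvb.ne, hab, rfl⟩]
    refine Set.ncard_le_ncard ?_ (Set.toFinite _)
    rintro x (rfl | rfl | rfl) <;> simp
  · refine induce_connected_of_forall_walk (c := v) (Set.mem_insert _ _) ?_
    rintro w (rfl | hw)
    · exact ⟨Walk.nil, by simp⟩
    · refine ⟨(p.takeUntil w hw).reverse.concat hva.symm, fun x hx => ?_⟩
      rw [Walk.support_concat] at hx
      simp only [Walk.support_reverse, List.mem_append, List.mem_reverse,
        List.mem_singleton] at hx
      rcases hx with hx | rfl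
      · exact Or.inr (p.support_takeUntil_subset_support hw hx)
      · exact Or.inl rfl
  · rintro x (rfl | hx)
    · refine induce_connected_of_forall_walk (c := a) ⟨Or.inr (by simp), hva.ne'⟩ ?_
      rintro w ⟨rfl | hw, hwx⟩
      · exact absurd rfl hwx
      · refine ⟨(p.takeUntil w hw).reverse, fun y hy => ?_⟩
        rw [Walk.support_reverse, List.mem_reverse] at hy
        have hy' := p.support_takeUntil_subset_support hw hy
        exact ⟨Or.inr hy', fun h => hv (h ▸ hy')⟩
    · have hvx : v ≠ x := fun h => hv (h ▸ hx)
      refine induce_connected_of_forall_walk (c := v) ⟨Set.mem_insert _ _, hvx⟩ ?_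
      rintro w ⟨rfl | hw, hwx⟩
      · exact ⟨Walk.nil, by simpa using hvx⟩
      · by_cases hxt : x ∈ (p.takeUntil w hw).support
        · refine ⟨(p.dropUntil w hw).concat hvb.symm, fun y hy => ?_⟩
          rw [Walk.support_concat] at hy
          simp only [List.mem_append, List.mem_singleton] at hy
          rcases hy with hy | rfl
          · refine ⟨Or.inr (p.support_dropUntil_subset_support hw hy), ?_⟩
            rintro rfl
            have hnd := hp.support_nodup
            rw [← p.take_spec hw, Walk.support_append] at hnd
            refine (List.disjoint_of_nodup_append hnd) hxt ?_
            rw [← Walk.cons_tail_support, List.mem_cons] at hy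
            exact hy.resolve_left fun h => hwx h.symm
          · exact ⟨Or.inl rfl, hvx⟩
        · refine ⟨(p.takeUntil w hw).reverse.concat hva.symm, fun y hy => ?_⟩
          rw [Walk.support_concat] at hy
          simp only [Walk.support_reverse, List.mem_append,
            List.mem_reverse, List.mem_singleton] at hy
          rcases hy with hy | rfl
          · exact ⟨Or.inr (p.support_takeUntil_subset_support hw hy), fun h => hxt (h ▸ hy)⟩
          · exact ⟨Or.inl rfl, hvx⟩

/-- In a block graph, the neighbourhood of a vertex that is not a cut-vertex is a clique. -/
theorem isClique_neighborSet_of_block [Finite V]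
    (hblock : ∀ S : Set V, TwoConnectedOn G S →
      (∀ T : Set V, S ⊆ T → TwoConnectedOn G T → S = T) → G.IsClique S)
    {v : V} (h : (G.induce ({v}ᶜ : Set V)).Connected) : G.IsClique (G.neighborSet v) := by
  intro a ha b hb hab
  obtain ⟨p, hp, hv⟩ := exists_isPath_avoiding h (G.ne_of_adj ha).symm (G.ne_of_adj hb).symm
  have h2 := twoConnectedOn_insert_support ha hb hab hp hv
  obtain ⟨S, hS, hmax⟩ := (Set.toFinite {S | TwoConnectedOn G S}).exists_le_maximal h2
  refine hblock S hmax.prop (fun T hST hT => hmax.eq_of_subset hT hST) ?_ ?_ hab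
  · exact hS (Or.inr (by simp))
  · exact hS (Or.inr (by simp))

/-- A vertex whose neighbourhood is a clique is not an inner vertex of a geodesic. -/
theorem eq_or_eq_of_isClique_neighborSet {v a b : V} (h : G.IsClique (G.neighborSet v))
    {p : G.Walk a b} (hp : p.length = G.dist a b) (hv : v ∈ p.support) : v = a ∨ v = b := by
  classical
  by_contra! hne
  set p₁ := p.takeUntil v hv with hp₁
  set p₂ := p.dropUntil v hv with hp₂
  have hlen : p₁.length + p₂.length = p.length := by
    rw [← Walk.length_append, p.take_spec hv]
  clear_value p₁ p₂
  obtain ⟨c, hc, q₂, rfl⟩ := Walk.exists_eq_cons_of_ne hne.2 p₂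
  obtain ⟨d, hd, q₁, hq₁⟩ := Walk.exists_eq_cons_of_ne hne.1 p₁.reverse
  have hl₁ : p₁.length = q₁.length + 1 := by
    rw [← Walk.length_reverse, hq₁, Walk.length_cons]
  rw [Walk.length_cons] at hlen
  by_cases hdc : d = c
  · subst hdc
    have := dist_le (q₁.reverse.append q₂)
    simp only [Walk.length_append, Walk.length_reverse] at this
    omega
  · have := dist_le (q₁.reverse.append (Walk.cons (h hd hc hdc) q₂))
    simp only [Walk.length_append, Walk.length_reverse, Walk.length_cons] at this
    omega

/-- For an edge `xy` there is a vertex that is not a cut-vertex and that `x` separates from `y`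
(possibly `x` itself): take one as far from `x` as possible. -/
theorem exists_not_cutVertex_separated [Finite V] (hconn : G.Connected) {x y : V}
    (hxy : G.Adj x y) : ∃ u : V, (G.induce ({u}ᶜ : Set V)).Connected ∧
      ∀ p : G.Walk u y, x ∈ p.support := by
  classical
  obtain ⟨u, hu, hmax⟩ := (Set.toFinite {u | ∀ p : G.Walk u y, x ∈ p.support}).exists_maximalFor
    (G.dist x) _ ⟨x, fun p => p.start_mem_support⟩
  refine ⟨u, ?_, hu⟩
  have huy : y ≠ u := by
    rintro rfl
    exact hxy.ne (by simpa using hu Walk.nil)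
  refine induce_connected_of_forall_walk (c := y) huy fun w hw => ?_
  suffices ∃ p : G.Walk w y, u ∉ p.support by
    obtain ⟨p, hp⟩ := this
    exact ⟨p, fun z hz h => hp (h ▸ hz)⟩
  by_cases hsep : ∀ p : G.Walk w y, x ∈ p.support
  · obtain ⟨q, hq⟩ := hconn.exists_walk_length_eq_dist w x
    refine ⟨q.concat hxy, fun hmem => ?_⟩
    rw [Walk.support_concat] at hmem
    simp only [List.mem_append, List.mem_singleton] at hmem
    have hmem := hmem.resolve_right huy.symm
    have h₁ : (q.takeUntil u hmem).length + (q.dropUntil u hmem).length = q.length := by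
      rw [← Walk.length_append, q.take_spec hmem]
    have h₂ := dist_le (q.dropUntil u hmem)
    have h₃ : 0 < (q.takeUntil u hmem).length :=
      (hconn.pos_dist_of_ne hw).trans_le (dist_le _)
    have h₄ : G.dist x w ≤ G.dist x u := by
      by_contra! hlt
      exact hlt.not_ge (hmax hsep hlt.le)
    rw [dist_comm, ← hq, dist_comm (u := x)] at h₄
    omega
  · push Not at hsep
    obtain ⟨p, hp⟩ := hsep
    exact ⟨p, fun hmem => hp (p.support_dropUntil_subset_support hmem (hu _))⟩

/-- If `x` separates `u` from `y` and `y` separates `v` from `x`, then `u` and `v` monitor the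
edge `xy`. -/
theorem monitors_of_separated (hconn : G.Connected) {x y u v : V} (hxy : G.Adj x y)
    (hu : ∀ p : G.Walk u y, x ∈ p.support) (hv : ∀ p : G.Walk v x, y ∈ p.support) :
    Monitors G u v s(x, y) := by
  classical
  refine ⟨hconn u v, fun p hp => ?_⟩
  obtain ⟨r, hr⟩ := (hconn v x).exists_isPath
  have hx : x ∈ p.support := by
    have := hu (p.append (r.takeUntil y (hv r)))
    rw [Walk.mem_support_append_iff] at this
    exact this.resolve_right (Walk.endpoint_notMem_support_takeUntil hr (hv r) hxy.ne)
  have hy : y ∈ (p.dropUntil x hx).support := by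
    simpa using hv (p.dropUntil x hx).reverse
  set p₁ := p.takeUntil x hx
  set p₂ := p.dropUntil x hx
  set q₁ := p₂.takeUntil y hy with hq₁
  set q₂ := p₂.dropUntil y hy
  have hlen : p₁.length + (q₁.length + q₂.length) = p.length := by
    rw [← Walk.length_append, p₂.take_spec hy, ← Walk.length_append, p.take_spec hx]
  have hle := dist_le (p₁.append (Walk.cons hxy q₂))
  rw [Walk.length_append, Walk.length_cons] at hle
  have hmem : s(x, y) ∈ q₁.edges := by
    have hq : q₁.length = 1 :=
      le_antisymm (by omega) ((hconn.pos_dist_of_ne hxy.ne).trans_le (dist_le _))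
    clear_value q₁
    obtain ⟨z, h, r, rfl⟩ := Walk.exists_eq_cons_of_ne hxy.ne q₁
    obtain rfl := Walk.eq_of_length_eq_zero (p := r) (by simpa using hq)
    simp
  exact p.edges_dropUntil_subset_edges hx (p₂.edges_takeUntil_subset_edges hy hmem)

end SimpleGraph

/-- In a connected graph the vertices that are not cut-vertices form an MEG-set. -/
theorem isMEGSet_not_cutVertex {V : Type*} [Finite V] {G : SimpleGraph V} (hconn : G.Connected) :
    IsMEGSet G {v : V | (G.induce ({v}ᶜ : Set V)).Connected} := by
  intro e he
  induction e with | _ x y =>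
  have hxy : G.Adj x y := he
  obtain ⟨u, hu, hux⟩ := exists_not_cutVertex_separated hconn hxy
  obtain ⟨v, hv, hvy⟩ := exists_not_cutVertex_separated hconn hxy.symm
  exact ⟨u, hu, v, hv, monitors_of_separated hconn hxy hux hvy⟩

/-- An MEG-set contains every non-isolated vertex whose neighbourhood is a clique. -/
theorem IsMEGSet.mem_of_isClique_neighborSet {V : Type*} {G : SimpleGraph V} {M : Set V}
    (hM : IsMEGSet G M) {v w : V} (hvw : G.Adj v w) (h : G.IsClique (G.neighborSet v)) :
    v ∈ M := by
  obtain ⟨a, ha, b, hb, hab, hmon⟩ := hM s(v, w) hvw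
  obtain ⟨p, hp⟩ := hab.exists_walk_length_eq_dist
  rcases eq_or_eq_of_isClique_neighborSet h hp
    (p.fst_mem_support_of_mem_edges (hmon p hp)) with rfl | rfl
  exacts [ha, hb]

/-- a connected block graph (every maximal 2-connected subgraph is a clique)
on `n ≥ 2` vertices with `k` cut-vertices satisfies `meg G = n - k`. -/
theorem meg_of_block_graph {V : Type*} [Fintype V] (G : SimpleGraph V)
    (hconn : G.Connected) (hn : 2 ≤ Fintype.card V)
    (hblock : ∀ S : Set V, TwoConnectedOn G S →
      (∀ T : Set V, S ⊆ T → TwoConnectedOn G T → S = T) → G.IsClique S)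
    (k : ℕ) (hk : {v : V | ¬ (G.induce ({v}ᶜ : Set V)).Connected}.ncard = k) :
    meg G = Fintype.card V - k := by
  classical
  have : Nontrivial V := Fintype.one_lt_card_iff_nontrivial.1 hn
  set N : Set V := {v : V | (G.induce ({v}ᶜ : Set V)).Connected} with hN
  have hcard : N.toFinset.card = Fintype.card V - k := by
    rw [← hk, ← Set.ncard_eq_toFinset_card', ← Nat.card_eq_fintype_card, ← Set.ncard_compl]
    congr 1
    ext v
    simp [hN]
  rw [← hcard]
  refine IsLeast.csInf_eq ⟨⟨N.toFinset, ?_, rfl⟩, ?_⟩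
  · rw [Set.coe_toFinset]
    exact isMEGSet_not_cutVertex hconn
  · rintro _ ⟨M, hM, rfl⟩
    refine Finset.card_le_card fun v hv => ?_
    rw [Set.mem_toFinset] at hv
    obtain ⟨w, hw⟩ := hconn.preconnected.exists_adj_of_nontrivial v
    exact hM.mem_of_isClique_neighborSet hw (isClique_neighborSet_of_block hblock hv)
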